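/- arXiv:2208.11987 — 2 statements merged into one kernel-verified Lean document; each statement's English description precedes it below -/
import Mathlib

section
/- Let n ∈ ℕ, let x₁, …, xₙ be distinct points of [0,1] and a₁, …, aₙ nonzero real numbers. Then the bounded linear functional φ on C([0,1],ℝ) defined by φ(f) = Σ_{k=1}^{n} aₖ f(xₖ) (a finite linear combination of Dirac point-evaluation functionals) has the adjusted Bhatia-Šemrl property. -/
open scoped BigOperators

section Defs

variable {E : Type*} [NormedAddCommGroup E] [NormedSpace ℝ E]

/-- Birkhoff-James orthogonality: `x ⊥_B y` iff `‖x‖ ≤ ‖x + t • y‖` for all real `t`. -/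
def BJOrth (x y : E) : Prop := ∀ t : ℝ, ‖x‖ ≤ ‖x + t • y‖

/-- Strong Birkhoff-James orthogonality: `x ⊥_S y` iff `‖x‖ < ‖x + t • y‖` for all real `t ≠ 0`. -/
def SBJOrth (x y : E) : Prop := ∀ t : ℝ, t ≠ 0 → ‖x‖ < ‖x + t • y‖

variable {X Y : Type*} [NormedAddCommGroup X] [NormedSpace ℝ X]
  [NormedAddCommGroup Y] [NormedSpace ℝ Y]

/-- A bounded linear operator attains its norm. -/
def NormAttaining (T : X →L[ℝ] Y) : Prop := ∃ x : X, ‖x‖ = 1 ∧ ‖T x‖ = ‖T‖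

/-- The adjusted Bhatia-Šemrl property. -/
def HasBSa (T : X →L[ℝ] Y) : Prop :=
  NormAttaining T ∧ ∀ S : X →L[ℝ] Y, SBJOrth T S →
    ∃ x : X, ‖x‖ = 1 ∧ ‖T x‖ = ‖T‖ ∧ BJOrth (T x) (S x)

/-- The Bhatia-Šemrl property. -/
def HasBS (T : X →L[ℝ] Y) : Prop :=
  NormAttaining T ∧ ∀ S : X →L[ℝ] Y, BJOrth T S →
    ∃ x : X, ‖x‖ = 1 ∧ ‖T x‖ = ‖T‖ ∧ BJOrth (T x) (S x)

end Defs

abbrev CI := C(Set.Icc (0:ℝ) 1, ℝ)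

theorem exists_bump (n : ℕ) (x : Fin n → Set.Icc (0:ℝ) 1) (hx : Function.Injective x)
    (k : Fin n) : ∃ h : CI, (∀ j, h (x j) = if j = k then 1 else 0) ∧ ∀ y, |h y| ≤ 1 := by
  have h1 : IsClosed (x '' {j | j ≠ k}) := (Set.toFinite _).isClosed
  have h2 : IsClosed ({x k} : Set (Set.Icc (0:ℝ) 1)) := isClosed_singleton
  have h3 : Disjoint (x '' {j | j ≠ k}) {x k} := by
    rw [Set.disjoint_singleton_right]
    rintro ⟨j, hj, e⟩
    exact hj (hx e)
  obtain ⟨h, h0, h1, h01⟩ := exists_continuous_zero_one_of_isClosed h1 h2 h3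
  refine ⟨h, fun j => ?_, fun y => ?_⟩
  · split_ifs with e
    · subst e
      exact h1 rfl
    · exact h0 ⟨j, e, rfl⟩
  · have := h01 y
    rw [abs_le]
    constructor <;> linarith [this.1, this.2]

theorem exists_correct (n : ℕ) (x : Fin n → Set.Icc (0:ℝ) 1) (hx : Function.Injective x)
    (s : Fin n → ℝ) (hs : ∀ k, |s k| = 1) (f : CI) (hf : ‖f‖ ≤ 1) :
    ∃ g : CI, ‖g‖ ≤ 1 ∧ (∀ k, g (x k) = s k) ∧ ‖f - g‖ ≤ ∑ k, (1 - s k * f (x k)) := by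
  choose h hh hb using exists_bump n x hx
  have hfy : ∀ y, |f y| ≤ 1 := fun y => (f.norm_coe_le_norm y).trans hf
  have hd : ∀ k, |s k - f (x k)| = 1 - s k * f (x k) := by
    intro k
    have := abs_le.1 (hfy (x k))
    rcases (abs_eq (zero_le_one)).1 (hs k) with e | e <;> rw [e]
    · rw [abs_of_nonneg] <;> linarith
    · rw [abs_of_nonpos] <;> linarith
  let u : CI := ∑ k, (s k - f (x k)) • h k
  have hu : ∀ y, u y = ∑ k, (s k - f (x k)) * h k y := by
    intro y
    simp [u, ContinuousMap.sum_apply]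
  let g : CI := ⟨fun y => max (-1) (min 1 (f y + u y)), by fun_prop⟩
  have hg : ∀ y, g y = max (-1) (min 1 (f y + u y)) := fun y => rfl
  refine ⟨g, ?_, fun k => ?_, ?_⟩
  · rw [ContinuousMap.norm_le _ zero_le_one]
    intro y
    rw [Real.norm_eq_abs, abs_le, hg]
    exact ⟨le_max_left _ _, max_le (by norm_num) (min_le_left _ _)⟩
  · have : u (x k) = s k - f (x k) := by
      rw [hu]
      simp [hh]
    rw [hg, this]
    rcases (abs_eq (zero_le_one)).1 (hs k) with e | e <;> rw [e] <;> norm_num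
  · have hD : ∀ y, |u y| ≤ ∑ k, (1 - s k * f (x k)) := by
      intro y
      rw [hu]
      refine (Finset.abs_sum_le_sum_abs _ _).trans (Finset.sum_le_sum fun k _ => ?_)
      rw [abs_mul, ← hd]
      exact mul_le_of_le_one_right (abs_nonneg _) (hb k y)
    rw [ContinuousMap.norm_le _ ((abs_nonneg _).trans (hD ⟨0, by simp⟩))]
    intro y
    refine le_trans ?_ (hD y)
    rw [ContinuousMap.sub_apply, Real.norm_eq_abs, hg]
    have := abs_le.1 (hfy y)
    have h1 := le_abs_self (u y)
    have h2 := neg_abs_le (u y)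
    rw [abs_le]
    rcases max_cases (-1) (min 1 (f y + u y)) with ⟨e, e'⟩ | ⟨e, e'⟩ <;>
    rcases min_cases 1 (f y + u y) with ⟨i, i'⟩ | ⟨i, i'⟩ <;>
    rw [e] <;> constructor <;> linarith

theorem key_dirac (n : ℕ) (x : Fin n → Set.Icc (0:ℝ) 1)
    (hx : Function.Injective x) (a s : Fin n → ℝ) (hs : ∀ k, |s k| = 1)
    (has : ∀ k, a k = |a k| * s k) (φ ψ : CI →L[ℝ] ℝ)
    (hφ : ∀ f : CI, φ f = ∑ k : Fin n, a k * f (x k)) (m : ℝ) (hm : 0 < m)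
    (hma : ∀ k, m ≤ |a k|)
    (hψ : ∀ g : CI, ‖g‖ ≤ 1 → (∀ k, g (x k) = s k) → 0 ≤ ψ g) :
    ∃ t : ℝ, t ≠ 0 ∧ ‖φ + t • ψ‖ ≤ ∑ k, |a k| := by
  have hp : 0 < ‖ψ‖ + 1 := by positivity
  set t := m / (‖ψ‖ + 1) with ht
  have ht0 : 0 < t := by positivity
  have htm : t * ‖ψ‖ ≤ m := by
    rw [ht, div_mul_eq_mul_div, div_le_iff₀ hp]
    nlinarith
  have main : ∀ f : CI, ‖f‖ ≤ 1 → (φ + (-t) • ψ) f ≤ ∑ k, |a k| := by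
    intro f hf
    obtain ⟨g, g1, g2, g3⟩ := exists_correct n x hx s hs f hf
    have p1 := hψ g g1 g2
    have p2 : |ψ (f - g)| ≤ ‖ψ‖ * ‖f - g‖ := ψ.le_opNorm _
    have p3 := (abs_le.1 p2).1
    rw [map_sub] at p3
    have hd : ∀ k, 0 ≤ 1 - s k * f (x k) := by
      intro k
      have : |s k * f (x k)| ≤ 1 := by
        rw [abs_mul, hs, one_mul]
        exact (f.norm_coe_le_norm _).trans hf
      linarith [(abs_le.1 this).2]
    have p4 : φ f = ∑ k, |a k| - ∑ k, |a k| * (1 - s k * f (x k)) := by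
      rw [hφ, ← Finset.sum_sub_distrib]
      refine Finset.sum_congr rfl fun k _ => ?_
      nth_rewrite 1 [has k]
      ring
    have p5 : m * ∑ k, (1 - s k * f (x k)) ≤ ∑ k, |a k| * (1 - s k * f (x k)) := by
      rw [Finset.mul_sum]
      exact Finset.sum_le_sum fun k _ => mul_le_mul_of_nonneg_right (hma k) (hd k)
    have p6 : t * (‖ψ‖ * ‖f - g‖) ≤ m * ∑ k, (1 - s k * f (x k)) := by
      rw [← mul_assoc]
      exact mul_le_mul htm g3 (norm_nonneg _) hm.le
    have p7 : 0 ≤ t * (ψ f + ‖ψ‖ * ‖f - g‖) := mul_nonneg ht0.le (by linarith)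
    simp only [ContinuousLinearMap.add_apply, ContinuousLinearMap.smul_apply, smul_eq_mul]
    linarith
  refine ⟨-t, by linarith [ht0] |> fun (h : -t < 0) => h.ne, ?_⟩
  refine ContinuousLinearMap.opNorm_le_of_unit_norm (Finset.sum_nonneg fun _ _ => abs_nonneg _) ?_
  intro f hf
  rw [Real.norm_eq_abs, abs_le]
  have h1 := main f hf.le
  have h2 := main (-f) (by rw [norm_neg]; exact hf.le)
  rw [map_neg] at h2
  constructor <;> linarith

/-- A nontrivial finite linear combination of Dirac point-evaluation functionals on
`C([0,1],ℝ)` has the adjusted Bhatia-Semrl property. -/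
theorem hasBSa_of_finite_combination_dirac (n : ℕ) (x : Fin n → Set.Icc (0:ℝ) 1)
    (hx : Function.Injective x) (a : Fin n → ℝ) (ha : ∀ k, a k ≠ 0)
    (φ : C(Set.Icc (0:ℝ) 1, ℝ) →L[ℝ] ℝ)
    (hφ : ∀ f : C(Set.Icc (0:ℝ) 1, ℝ), φ f = ∑ k : Fin n, a k * f (x k)) :
    HasBSa φ := by
  rcases Nat.eq_zero_or_pos n with hn | hn
  · subst hn
    have h0 : φ = 0 := by
      ext f
      simp [hφ]
    subst h0
    refine ⟨⟨1, by simp, by simp⟩, fun S _ => ⟨1, by simp, by simp, fun t => by simp; positivity⟩⟩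
  haveI : Nonempty (Fin n) := ⟨⟨0, hn⟩⟩
  obtain ⟨k0, hk0⟩ := Finite.exists_min (fun k => |a k|)
  let s : Fin n → ℝ := fun k => a k / |a k|
  have hpos : ∀ k, 0 < |a k| := fun k => abs_pos.2 (ha k)
  have hs : ∀ k, |s k| = 1 := fun k => by
    simp only [s, abs_div, abs_abs]
    exact div_self (hpos k).ne'
  have has : ∀ k, a k = |a k| * s k := fun k => by
    simp only [s]
    rw [mul_div_cancel₀ _ (hpos k).ne']
  have hval : ∀ g : CI, (∀ k, g (x k) = s k) → φ g = ∑ k, |a k| := by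
    intro g hg
    rw [hφ]
    refine Finset.sum_congr rfl fun k _ => ?_
    rw [hg, has k, mul_assoc, ← abs_mul_abs_self (s k), hs, abs_mul, abs_abs, hs]
    ring
  have hone : ∀ g : CI, ‖g‖ ≤ 1 → (∀ k, g (x k) = s k) → ‖g‖ = 1 := by
    intro g h1 h2
    refine le_antisymm h1 ?_
    have h3 : |g (x k0)| ≤ ‖g‖ := g.norm_coe_le_norm _
    rw [h2 k0] at h3
    linarith [hs k0]
  obtain ⟨g0, hg0, hg0', -⟩ := exists_correct n x hx s hs 0 (by simp)
  have hle : ‖φ‖ ≤ ∑ k, |a k| := by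
    refine ContinuousLinearMap.opNorm_le_of_unit_norm
      (Finset.sum_nonneg fun _ _ => abs_nonneg _) fun f hf => ?_
    rw [hφ]
    refine (Finset.abs_sum_le_sum_abs _ _).trans (Finset.sum_le_sum fun k _ => ?_)
    rw [abs_mul]
    exact mul_le_of_le_one_right (abs_nonneg _) ((f.norm_coe_le_norm _).trans hf.le)
  have hsum : 0 ≤ ∑ k, |a k| := Finset.sum_nonneg fun _ _ => abs_nonneg _
  have hnorm : ‖φ‖ = ∑ k, |a k| := by
    refine le_antisymm hle ?_
    have := φ.le_opNorm g0
    rw [hval g0 hg0', hone g0 hg0 hg0', mul_one, Real.norm_eq_abs, abs_of_nonneg hsum] at this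
    exact this
  have hatt : ∀ g : CI, (∀ k, g (x k) = s k) → ‖φ g‖ = ‖φ‖ := by
    intro g hg
    rw [hval g hg, hnorm, Real.norm_eq_abs, abs_of_nonneg hsum]
  refine ⟨⟨g0, hone g0 hg0 hg0', hatt g0 hg0'⟩, fun ψ hψ => ?_⟩
  have hex : ∃ g : CI, ‖g‖ ≤ 1 ∧ (∀ k, g (x k) = s k) ∧ ψ g = 0 := by
    have e1 : ∃ g : CI, ‖g‖ ≤ 1 ∧ (∀ k, g (x k) = s k) ∧ ψ g < 0 := by
      by_contra! hc
      obtain ⟨t, ht, h⟩ := key_dirac n x hx a s hs has φ ψ hφ _ (hpos k0) hk0 hc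
      have := hψ t ht
      linarith
    have e2 : ∃ g : CI, ‖g‖ ≤ 1 ∧ (∀ k, g (x k) = s k) ∧ 0 < ψ g := by
      by_contra! hc
      obtain ⟨t, ht, h⟩ := key_dirac n x hx a s hs has φ (-ψ) hφ _ (hpos k0) hk0
        (fun g h1 h2 => by
          have := hc g h1 h2
          simpa using this)
      have := hψ (-t) (neg_ne_zero.2 ht)
      rw [smul_neg, ← neg_smul] at h
      linarith
    obtain ⟨g, g1, g2, g3⟩ := e1
    obtain ⟨f, f1, f2, f3⟩ := e2
    have hd : 0 < ψ f - ψ g := by linarith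
    set c := ψ f / (ψ f - ψ g) with hc
    have c0 : 0 ≤ c := by positivity
    have c1 : 0 ≤ 1 - c := by
      rw [sub_nonneg, hc, div_le_one hd]
      linarith
    refine ⟨c • g + (1 - c) • f, ?_, fun k => ?_, ?_⟩
    · refine (norm_add_le _ _).trans ?_
      rw [norm_smul, norm_smul, Real.norm_of_nonneg c0, Real.norm_of_nonneg c1]
      nlinarith
    · simp [g2, f2]
      ring
    · simp only [map_add, map_smul, smul_eq_mul]
      have : c * (ψ f - ψ g) = ψ f := div_mul_cancel₀ _ hd.ne'
      linarith
  obtain ⟨g, g1, g2, g3⟩ := hex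
  refine ⟨g, hone g g1 g2, hatt g g2, fun t => ?_⟩
  rw [g3, smul_zero, add_zero]
end

section
/- The set BSa(C([0,1],ℝ),ℝ) of bounded linear functionals on C([0,1],ℝ) having the adjusted Bhatia-Šemrl property is not norm-dense in the dual space C([0,1],ℝ)*; indeed, there exists a bounded linear functional μ on C([0,1],ℝ) such that every functional ν with the adjusted Bhatia-Šemrl property satisfies ‖μ − ν‖ ≥ 1/2. -/
open scoped BigOperators

open MeasureTheory

lemma aux_bd (ν : C(Set.Icc (0:ℝ) 1, ℝ) →L[ℝ] ℝ) (h : C(Set.Icc (0:ℝ) 1, ℝ)) (c : ℝ) (hc : 0 ≤ c)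
    (hh : ∀ p, |h p| ≤ c) : |ν h| ≤ ‖ν‖ * c := by
  have h1 : ‖h‖ ≤ c := (ContinuousMap.norm_le h hc).2 hh
  have h2 := ν.le_opNorm h
  rw [Real.norm_eq_abs] at h2
  exact h2.trans (mul_le_mul_of_nonneg_left h1 (norm_nonneg _))

lemma aux_dom (ν : C(Set.Icc (0:ℝ) 1, ℝ) →L[ℝ] ℝ) (x₀ : C(Set.Icc (0:ℝ) 1, ℝ))
    (hx : ∀ p, |x₀ p| ≤ 1) (hν : ν x₀ = ‖ν‖) (f : C(Set.Icc (0:ℝ) 1, ℝ)) :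
    ν f ≤ ν (x₀ * |f|) := by
  have h1 : ∀ p, |(‖f‖ • x₀ - x₀ * |f| + f) p| ≤ ‖f‖ := by
    intro p
    have h2 : |f p| ≤ ‖f‖ := f.norm_coe_le_norm p
    have h3 := hx p
    simp only [ContinuousMap.add_apply, ContinuousMap.sub_apply, ContinuousMap.smul_apply,
      ContinuousMap.mul_apply, ContinuousMap.abs_apply, smul_eq_mul]
    calc |‖f‖ * x₀ p - x₀ p * |f p| + f p| = |(‖f‖ - |f p|) * x₀ p + f p| := by ring_nf
      _ ≤ |(‖f‖ - |f p|) * x₀ p| + |f p| := abs_add_le _ _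
      _ = (‖f‖ - |f p|) * |x₀ p| + |f p| := by rw [abs_mul, abs_of_nonneg (sub_nonneg.2 h2)]
      _ ≤ ‖f‖ := by nlinarith [mul_le_mul_of_nonneg_left h3 (sub_nonneg.2 h2)]
  have h4 := (le_abs_self _).trans (aux_bd ν _ _ (norm_nonneg f) h1)
  simp only [map_add, map_sub, map_smul, smul_eq_mul, hν] at h4
  linarith

lemma aux_measure (ν : C(Set.Icc (0:ℝ) 1, ℝ) →L[ℝ] ℝ) (x₀ : C(Set.Icc (0:ℝ) 1, ℝ))
    (hx : ∀ p, |x₀ p| ≤ 1) (hν : ν x₀ = ‖ν‖) :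
    ∃ ρ : Measure (Set.Icc (0:ℝ) 1), IsFiniteMeasure ρ ∧ ∀ f : C(Set.Icc (0:ℝ) 1, ℝ),
      ν (x₀ * f) = ∫ p, f p ∂ρ := by
  let Λl : CompactlySupportedContinuousMap (Set.Icc (0:ℝ) 1) ℝ →ₗ[ℝ] ℝ :=
    { toFun := fun f => ν (x₀ * f.toContinuousMap)
      map_add' := by
        intro f g
        rw [← map_add, ← mul_add]; rfl
      map_smul' := by
        intro c f
        rw [RingHom.id_apply, ← map_smul, ← mul_smul_comm]; rfl }
  let Λ : CompactlySupportedContinuousMap (Set.Icc (0:ℝ) 1) ℝ →ₚ[ℝ] ℝ :=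
    PositiveLinearMap.mk₀ Λl (by
      intro f hf
      have h0 : |f.toContinuousMap| = f.toContinuousMap := by
        ext p
        exact abs_of_nonneg (hf p)
      have h1 := aux_dom ν x₀ hx hν f.toContinuousMap
      have h2 := aux_dom ν x₀ hx hν (-f.toContinuousMap)
      rw [abs_neg, map_neg] at h2
      rw [h0] at h1 h2
      change 0 ≤ ν (x₀ * f.toContinuousMap)
      linarith)
  have : (RealRMK.rieszMeasure Λ).Regular := RealRMK.regular_rieszMeasure Λ
  refine ⟨RealRMK.rieszMeasure Λ, inferInstance, fun f => ?_⟩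
  exact (RealRMK.integral_rieszMeasure Λ (CompactlySupportedContinuousMap.continuousMapEquiv f)).symm

lemma aux_int (ρ : Measure (Set.Icc (0:ℝ) 1)) [IsFiniteMeasure ρ] (f : C(Set.Icc (0:ℝ) 1, ℝ)) :
    Integrable (fun p => f p) ρ :=
  f.continuous.integrable_of_hasCompactSupport (HasCompactSupport.of_compactSpace f)

/-- zeros of norming vectors are off the support -/
lemma aux_zero (ν : C(Set.Icc (0:ℝ) 1, ℝ) →L[ℝ] ℝ) (x₀ : C(Set.Icc (0:ℝ) 1, ℝ))
    (hx : ∀ p, |x₀ p| ≤ 1)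
    (ρ : Measure (Set.Icc (0:ℝ) 1)) [IsFiniteMeasure ρ]
    (hρ : ∀ f : C(Set.Icc (0:ℝ) 1, ℝ), ν (x₀ * f) = ∫ p, f p ∂ρ)
    (x₁ : C(Set.Icc (0:ℝ) 1, ℝ)) (hx₁ : ∀ p, |x₁ p| ≤ 1) (hν₁ : |ν x₁| = ‖ν‖)
    (p : Set.Icc (0:ℝ) 1) (hp : x₁ p = 0) : p ∉ ρ.support := by
  have key : ∀ s : ℝ, |s| = 1 → |ν x₁ + s * ν (x₀ * (1 - |x₁|))| ≤ ‖ν‖ := by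
    intro s hs
    have := aux_bd ν (x₁ + s • (x₀ * (1 - |x₁|))) 1 zero_le_one (by
      intro q
      simp only [ContinuousMap.add_apply, ContinuousMap.sub_apply, ContinuousMap.smul_apply,
        ContinuousMap.mul_apply, ContinuousMap.abs_apply, smul_eq_mul, ContinuousMap.one_apply]
      have h1 := hx q
      have h2 := hx₁ q
      refine (abs_add_le _ _).trans ?_
      rw [abs_mul, abs_mul, hs, abs_of_nonneg (sub_nonneg.2 h2)]
      nlinarith [mul_le_mul_of_nonneg_right h1 (sub_nonneg.2 h2)])
    simpa using this
  have h0 : ν (x₀ * (1 - |x₁|)) = 0 := by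
    have h1 := key 1 (by simp)
    have h2 := key (-1) (by simp)
    rw [← hν₁] at h1 h2
    rcases abs_cases (ν x₁) with ⟨h3, _⟩ | ⟨h3, _⟩ <;> rw [h3, abs_le] at h1 h2 <;> linarith
  rw [hρ] at h0
  rw [integral_eq_zero_iff_of_nonneg _ (aux_int ρ _)] at h0
  · rw [Measure.notMem_support_iff_exists]
    refine ⟨{q | |x₁ q| < 1}, ?_, ?_⟩
    · apply IsOpen.mem_nhds
      · exact isOpen_lt (by fun_prop) continuous_const
      · simp [hp]
    · refine measure_mono_null ?_ (ae_iff.1 h0)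
      intro q hq
      have hq' : |x₁ q| < 1 := hq
      simp only [Set.mem_ofPred_eq, ContinuousMap.sub_apply, ContinuousMap.abs_apply,
        ContinuousMap.one_apply, Pi.zero_apply]
      intro h; linarith
  · intro q
    simpa using hx₁ q

lemma aux_support (ν : C(Set.Icc (0:ℝ) 1, ℝ) →L[ℝ] ℝ) (hB : HasBSa ν) (hne : ‖ν‖ ≠ 0)
    (x₀ : C(Set.Icc (0:ℝ) 1, ℝ))
    (hx : ∀ p, |x₀ p| ≤ 1) (hν : ν x₀ = ‖ν‖)
    (ρ : Measure (Set.Icc (0:ℝ) 1)) [IsFiniteMeasure ρ]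
    (hρ : ∀ f : C(Set.Icc (0:ℝ) 1, ℝ), ν (x₀ * f) = ∫ p, f p ∂ρ)
    (p : Set.Icc (0:ℝ) 1) (hp : p ∈ ρ.support) : 0 < ρ {p} := by
  by_contra hcon
  have hp0 : ρ {p} = 0 := by simpa using hcon
  have hx0p : x₀ p ≠ 0 := fun h =>
    aux_zero ν x₀ hx ρ hρ x₀ hx (by rw [hν]; exact abs_of_nonneg ν.opNorm_nonneg) p h hp
  have hS : SBJOrth ν (ContinuousMap.evalCLM ℝ p : C(Set.Icc (0:ℝ) 1, ℝ) →L[ℝ] ℝ) := by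
    intro t ht
    by_contra hle
    rw [not_lt] at hle
    have hb : ∀ h : C(Set.Icc (0:ℝ) 1, ℝ), (∀ q, |h q| ≤ 1) → ν h + t * h p ≤ ‖ν‖ := by
      intro h hh
      have := (le_abs_self _).trans (aux_bd (ν + t • ContinuousMap.evalCLM ℝ p) h 1 zero_le_one hh)
      simp at this
      linarith
    have hc : 0 < |t * x₀ p| := abs_pos.2 (mul_ne_zero ht hx0p)
    obtain ⟨U, hpU, hUo, hU⟩ := Set.exists_isOpen_lt_of_lt ({p} : Set (Set.Icc (0:ℝ) 1))
      (μ := ρ) (ENNReal.ofReal (|t * x₀ p| / 2)) (by rw [hp0]; simpa using hc)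
    obtain ⟨φ, hφ0, hφ1, hφ⟩ := exists_continuous_zero_one_of_isClosed hUo.isClosed_compl
      (isClosed_singleton (x := p)) (by
        rw [Set.disjoint_singleton_right]; simpa using hpU)
    have hφp : φ p = 1 := hφ1 rfl
    have h1 := hb x₀ hx
    have h2 := hb (x₀ - (2:ℝ) • (x₀ * φ)) (by
      intro q
      have h3 := hφ q
      have h4 := hx q
      have h5 : (x₀ - (2:ℝ) • (x₀ * φ)) q = x₀ q * (1 - 2 * φ q) := by
        simp; ring
      rw [h5, abs_mul]
      have h6 : |1 - 2 * φ q| ≤ 1 := by rw [abs_le]; constructor <;> linarith [h3.1, h3.2]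
      exact mul_le_one₀ h4 (abs_nonneg _) h6)
    have h5 : (x₀ - (2:ℝ) • (x₀ * φ)) p = - x₀ p := by
      simp [hφp]; ring
    rw [h5, map_sub, map_smul, hρ, hν, smul_eq_mul] at h2
    rw [hν] at h1
    have h6 : |t * x₀ p| = -(t * x₀ p) := abs_of_nonpos (by linarith)
    have h7 : ∫ q, φ q ∂ρ ≤ ρ.real U := by
      rw [← integral_indicator_one hUo.measurableSet]
      apply integral_mono (aux_int ρ φ)
      · exact (integrable_const (1:ℝ)).indicator hUo.measurableSet
      · intro q
        by_cases hq : q ∈ U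
        · simpa [hq] using (hφ q).2
        · have : φ q = 0 := hφ0 hq
          simp [hq, this]
    have h8 : ρ.real U < |t * x₀ p| / 2 := by
      rw [Measure.real]
      exact (ENNReal.lt_ofReal_iff_toReal_lt (measure_ne_top _ _)).1 hU
    linarith
  obtain ⟨x₁, h1, h2, h3⟩ := hB.2 _ hS
  have hz : x₁ p = 0 := by
    by_contra hz
    have := h3 (-(ν x₁) / x₁ p)
    rw [h2] at this
    simp [hz] at this
    exact hne (by rw [this]; exact ContinuousLinearMap.opNorm_zero)
  exact aux_zero ν x₀ hx ρ hρ x₁ (fun q => (x₁.norm_coe_le_norm q).trans h1.le) h2 p hz hp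

noncomputable def auxL : C(Set.Icc (0:ℝ) 1, ℝ) →L[ℝ] ℝ :=
  LinearMap.mkContinuous
    { toFun := fun f => ∫ p : unitInterval, f p
      map_add' := fun f g => integral_add (aux_int (volume : Measure unitInterval) f) (aux_int _ g)
      map_smul' := fun c f => integral_const_mul c _ } 1 (by
    intro f
    have := norm_integral_le_of_norm_le_const (μ := (volume : Measure unitInterval))
      (f := fun p => f p) (C := ‖f‖) (Filter.Eventually.of_forall fun p => f.norm_coe_le_norm p)
    simpa using this)

lemma auxL_apply (f : C(Set.Icc (0:ℝ) 1, ℝ)) : auxL f = ∫ p : unitInterval, f p := rfl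

lemma aux_final (ν : C(Set.Icc (0:ℝ) 1, ℝ) →L[ℝ] ℝ) (S : Set unitInterval) (hSc : IsClosed S)
    (hS : volume S = 0)
    (h : ∀ f : C(Set.Icc (0:ℝ) 1, ℝ), (∀ p ∈ S, f p = 0) → ν f = 0) : (1:ℝ)/2 ≤ ‖auxL - ν‖ := by
  obtain ⟨U, hSU, hUo, hU⟩ := Set.exists_isOpen_lt_of_lt S (ENNReal.ofReal (1/2))
      (μ := volume) (by rw [hS]; simp)
  obtain ⟨φ, hφ0, hφ1, hφ⟩ := exists_continuous_zero_one_of_isClosed hSc hUo.isClosed_compl (by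
    rw [Set.disjoint_compl_right_iff_subset]; exact hSU)
  have h1 := (le_abs_self _).trans (aux_bd (auxL - ν) φ 1 zero_le_one (fun p => by
    rw [abs_of_nonneg (hφ p).1]; exact (hφ p).2))
  rw [sub_apply, h φ (fun p hp => hφ0 hp), auxL_apply] at h1
  have h7 : volume.real Uᶜ ≤ ∫ q : unitInterval, φ q := by
    rw [← integral_indicator_one hUo.measurableSet.compl]
    apply integral_mono _ (aux_int (volume : Measure unitInterval) φ)
    · intro q
      by_cases hq : q ∈ U
      · simpa [hq] using (hφ q).1
      · have : φ q = 1 := hφ1 hq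
        simp [hq, this]
    · exact (integrable_const (1:ℝ)).indicator hUo.measurableSet.compl
  have h8 : volume.real U < 1 / 2 := by
    rw [Measure.real]
    exact (ENNReal.lt_ofReal_iff_toReal_lt (measure_ne_top _ _)).1 hU
  rw [probReal_compl_eq_one_sub hUo.measurableSet] at h7
  linarith

lemma aux_main (ν : C(Set.Icc (0:ℝ) 1, ℝ) →L[ℝ] ℝ) (hB : HasBSa ν) : (1:ℝ)/2 ≤ ‖auxL - ν‖ := by
  by_cases hne : ‖ν‖ = 0
  · have : ν = 0 := (ContinuousLinearMap.opNorm_zero_iff ν).1 hne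
    exact aux_final ν ∅ isClosed_empty measure_empty (by simp [this])
  have hx : ∃ x₀ : C(Set.Icc (0:ℝ) 1, ℝ), ‖x₀‖ = 1 ∧ ν x₀ = ‖ν‖ := by
    obtain ⟨x, hx1, hx2⟩ := hB.1
    rcases abs_choice (ν x) with h | h
    · exact ⟨x, hx1, by rw [← hx2, Real.norm_eq_abs, h]⟩
    · exact ⟨-x, by rw [norm_neg, hx1], by rw [← hx2, Real.norm_eq_abs, h, map_neg]⟩
  obtain ⟨x₀, hx1, hν⟩ := hx
  have hx : ∀ p, |x₀ p| ≤ 1 := fun q => (x₀.norm_coe_le_norm q).trans hx1.le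
  obtain ⟨ρ, hfin, hρ⟩ := aux_measure ν x₀ hx hν
  have hsup := aux_support ν hB hne x₀ hx hν ρ hρ
  have hcount : ρ.support.Countable := by
    refine Set.Countable.mono (s₂ := {p | 0 < ρ {p}}) hsup ?_
    exact Measure.countable_meas_pos_of_disjoint_iUnion (μ := ρ) (As := fun p => {p})
      (fun p => measurableSet_singleton p) (fun p q h => by simpa using h)
  refine aux_final ν ρ.support Measure.isClosed_support (hcount.measure_zero _) ?_
  intro f hf
  have hz : ν (x₀ * |f|) = 0 := by
    rw [hρ]
    apply integral_eq_zero_of_ae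
    filter_upwards [Measure.support_mem_ae (μ := ρ)] with p hp
    simp [hf p hp]
  have h1 := aux_dom ν x₀ hx hν f
  have h2 := aux_dom ν x₀ hx hν (-f)
  rw [abs_neg, map_neg] at h2
  linarith

theorem not_dense_hasBSa_C01 :
    (¬ Dense {f : C(Set.Icc (0:ℝ) 1, ℝ) →L[ℝ] ℝ | HasBSa f}) ∧
      ∃ μ : C(Set.Icc (0:ℝ) 1, ℝ) →L[ℝ] ℝ,
        ∀ ν : C(Set.Icc (0:ℝ) 1, ℝ) →L[ℝ] ℝ, HasBSa ν → (1:ℝ)/2 ≤ ‖μ - ν‖ := by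
  refine ⟨fun hd => ?_, auxL, aux_main⟩
  obtain ⟨ν, hν, hlt⟩ := hd.exists_dist_lt auxL (ε := 1/2) (by norm_num)
  have h1 : ‖auxL - ν‖ < 1 / 2 := lt_of_eq_of_lt (dist_eq_norm auxL ν).symm hlt
  linarith [aux_main ν hν]
end
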